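/- Let the outcome take K ≥ 2 values: Y(0), Y(1) : Ω → 𝒴 = {y₁, …, y_K} and Y := Y(D). Fix x ∈ 𝒳 with P(X = x) > 0 and suppose: (Randomization) under P(·|S = e, X = x), D is independent of the pair (Y(0), Y(1)); (Positivity) P(S = e, X = x, D = d, Y = y_j) > 0 and P(S = o, X = x, Y = y_j) > 0 for all d ∈ {0, 1}, j ∈ {1, …, K}; (Stability) R is conditionally independent of S given (X, D, Y); (No direct effect) R is conditionally independent of D given (X, Y). Define μ(d, x) ∈ ℝ^{K−1} with j-th entry P(Y(d) = y_j | S = e, X = x), the scalar Δᵉ(d) := 1{D = d, S = e}/P(D = d, S = e | X = x) − 1{Y = y_K, S = o}/P(Y = y_K, S = o | X = x), and the ℝ^{K−1}-valued Δᵒ with j-th entry 1{Y = y_j, S = o}/P(Y = y_j, S = o | X = x) − 1{Y = y_K, S = o}/P(Y = y_K, S = o | X = x). Then for any J ≥ K − 1 and any bounded measurable H : 𝒳 × ℛ → ℝ^J, one has the vector identity E[H(x, R)·Δᵉ(d) | X = x] = M·μ(d, x), where M := E[H(x, R)·(Δᵒ)ᵀ | X = x] ∈ ℝ^{J×(K−1)}.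 Moreover, if M has rank K − 1, then μ(d, x) is the unique vector m ∈ ℝ^{K−1} satisfying E[H(x, R)·Δᵉ(d) | X = x] = M·m. -/

import Mathlib

open MeasureTheory ProbabilityTheory

noncomputable section

/-- Sample indicator values: experimental (`e`) or observational (`o`). -/
inductive Sample : Type
  | e
  | o
deriving DecidableEq

instance : MeasurableSpace Sample := ⊤

/-- Real-valued indicator of a boolean (`{0,1}`-valued variable). -/
def b2r (b : Bool) : ℝ := if b then 1 else 0

/-- `CondIndepOf P R V W` : the conditional law of `R` given `V = v, W = w` agrees with
the conditional law of `R` given `V = v`, for all values with positive probability;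
this is the notion of "R is conditionally independent of W given V" for variables with
countable ranges. -/
def CondIndepOf {Ω 𝓡 V W : Type*} [MeasurableSpace Ω] [MeasurableSpace 𝓡]
    (P : Measure Ω) (R : Ω → 𝓡) (Vf : Ω → V) (Wf : Ω → W) : Prop :=
  ∀ v w, 0 < P {ω | Vf ω = v ∧ Wf ω = w} →
    (P[|{ω | Vf ω = v ∧ Wf ω = w}]).map R = (P[|{ω | Vf ω = v}]).map R

/-- If `R` has the same conditional law given `B` and given `C`, then `f ∘ R` integrates over `B`
to `P B` times its conditional mean given `C`. -/
lemma setIntegral_eq_of_cond_map_eq {Ω 𝓡 : Type*} [MeasurableSpace Ω] [MeasurableSpace 𝓡]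
    {P : Measure Ω} [IsProbabilityMeasure P] {R : Ω → 𝓡} (hR : Measurable R)
    {f : 𝓡 → ℝ} (hf : Measurable f) {B C : Set Ω}
    (h : 0 < P B → (P[|B]).map R = (P[|C]).map R) :
    ∫ ω in B, f (R ω) ∂P = P.real B * ∫ ω, f (R ω) ∂(P[|C]) := by
  rcases eq_or_ne (P B) 0 with h0 | h0
  · simp [Measure.restrict_eq_zero.2 h0, measureReal_def, h0]
  · rw [← integral_map (μ := P[|C]) hR.aemeasurable hf.aestronglyMeasurable,
      ← h (pos_iff_ne_zero.2 h0),
      integral_map hR.aemeasurable hf.aestronglyMeasurable, ProbabilityTheory.cond,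
      integral_smul_measure, smul_eq_mul, ENNReal.toReal_inv, ← measureReal_def, ← mul_assoc,
      mul_inv_cancel₀, one_mul]
    exact (ENNReal.toReal_pos h0 (measure_ne_top _ _)).ne'

/-- Integrating against a conditionally normalised indicator gives a conditional mean. -/
lemma integral_mul_indicator_div_cond {Ω : Type*} [MeasurableSpace Ω]
    {P : Measure Ω} [IsProbabilityMeasure P] {A : Set Ω} (hA : MeasurableSet A) (hA0 : P A ≠ 0)
    (g : Ω → ℝ) {p : Ω → Prop} [DecidablePred p] (hp : MeasurableSet {ω | p ω}) :
    ∫ ω, g ω * ((if p ω then (1 : ℝ) else 0) / ((P[|A]) {ω | p ω}).toReal) ∂(P[|A]) =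
      (∫ ω in A ∩ {ω | p ω}, g ω ∂P) / P.real (A ∩ {ω | p ω}) := by
  have hA' : P.real A ≠ 0 := (ENNReal.toReal_pos hA0 (measure_ne_top _ _)).ne'
  have h1 : ∀ ω, g ω * ((if p ω then (1 : ℝ) else 0) / ((P[|A]) {ω | p ω}).toReal) =
      ({ω | p ω}.indicator g ω) * (((P[|A]) {ω | p ω}).toReal)⁻¹ := by
    intro ω
    by_cases h : p ω <;> simp [h, div_eq_mul_inv]
  simp_rw [h1]
  rw [integral_mul_const, integral_indicator hp, cond_apply hA, ProbabilityTheory.cond,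
    Measure.restrict_smul, integral_smul_measure, Measure.restrict_restrict hp,
    Set.inter_comm {ω | p ω} A, smul_eq_mul, ENNReal.toReal_mul, ENNReal.toReal_inv,
    ← measureReal_def, ← measureReal_def]
  field_simp

/-- A set integral splits along the fibres of a function with finite range. -/
lemma setIntegral_eq_sum_fiber {Ω ι : Type*} [MeasurableSpace Ω] [Fintype ι]
    [MeasurableSpace ι] [MeasurableSingletonClass ι] {P : Measure Ω} {Z : Ω → ι}
    (hZ : Measurable Z) {B : Set Ω} (hB : MeasurableSet B) {g : Ω → ℝ} (hg : Integrable g P) :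
    ∫ ω in B, g ω ∂P = ∑ i, ∫ ω in B ∩ {ω | Z ω = i}, g ω ∂P := by
  have hU : B = ⋃ i, B ∩ {ω | Z ω = i} := by ext ω; simp
  conv_lhs => rw [hU]
  refine integral_iUnion_fintype (fun i => hB.inter (hZ (measurableSet_singleton i))) ?_
    (fun i => hg.integrableOn)
  intro i j hij
  refine Set.disjoint_left.2 fun ω h1 h2 => hij ?_
  exact h1.2.symm.trans h2.2

/-- **Corollary (Identification as representation), discrete outcome.**
For any `J ≥ K − 1` and any bounded measurable `H : 𝒳 × ℛ → ℝ^J`,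
`E[H(x,R)·Δᵉ(d) | X = x] = M·μ(d,x)` where `M = E[H(x,R)·(Δᵒ)ᵀ | X = x]`; and if `M` has
rank `K − 1` then `μ(d,x)` is the unique solution of this linear system. -/
theorem statement12
    {Ω 𝓡 𝓧 : Type*} [MeasurableSpace Ω] [MeasurableSpace 𝓡] [StandardBorelSpace 𝓡]
    [MeasurableSpace 𝓧] [MeasurableSingletonClass 𝓧] [Countable 𝓧]
    (P : Measure Ω) [IsProbabilityMeasure P]
    (n : ℕ) (hn : 1 ≤ n)   -- K = n + 1 ≥ 2
    (S : Ω → Sample) (D : Ω → Bool) (Y0 Y1 : Ω → Fin (n + 1)) (R : Ω → 𝓡) (X : Ω → 𝓧)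
    (hS : Measurable S) (hD : Measurable D) (hY0 : Measurable Y0) (hY1 : Measurable Y1)
    (hR : Measurable R) (hX : Measurable X)
    (Y : Ω → Fin (n + 1)) (hYdef : ∀ ω, Y ω = if D ω then Y1 ω else Y0 ω)
    (x : 𝓧) (hx : 0 < P {ω | X ω = x})
    -- Randomization: D ⫫ (Y(0), Y(1)) under P(·|S = e, X = x)
    (randomization :
      IndepFun D (fun ω => (Y0 ω, Y1 ω)) (P[|{ω | S ω = Sample.e ∧ X ω = x}]))
    -- Positivity
    (positivity_e : ∀ (d : Bool) (j : Fin (n + 1)),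
      0 < P {ω | S ω = Sample.e ∧ X ω = x ∧ D ω = d ∧ Y ω = j})
    (positivity_o : ∀ j : Fin (n + 1),
      0 < P {ω | S ω = Sample.o ∧ X ω = x ∧ Y ω = j})
    -- Stability: R ⫫ S | (X, D, Y)
    (stability : CondIndepOf P R (fun ω => (X ω, D ω, Y ω)) S)
    -- No direct effect: R ⫫ D | (X, Y)
    (noDirectEffect : CondIndepOf P R (fun ω => (X ω, Y ω)) D)
    (d : Bool)
    -- μ(d, x) ∈ ℝ^{K−1}, with j-th entry P(Y(d) = y_j | S = e, X = x)
    (μ : Fin n → ℝ)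
    (hμ : ∀ j : Fin n, μ j =
      ((P[|{ω | S ω = Sample.e ∧ X ω = x}])
        {ω | (if d then Y1 ω else Y0 ω) = j.castSucc}).toReal)
    -- Δᵉ(d) := 1{D=d,S=e}/P(D=d,S=e|X=x) − 1{Y=y_K,S=o}/P(Y=y_K,S=o|X=x)
    (Δe : Ω → ℝ)
    (hΔe : ∀ ω, Δe ω =
      (if D ω = d ∧ S ω = Sample.e then (1 : ℝ) else 0) /
        ((P[|{ω' | X ω' = x}]) {ω' | D ω' = d ∧ S ω' = Sample.e}).toReal -
      (if Y ω = Fin.last n ∧ S ω = Sample.o then (1 : ℝ) else 0) /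
        ((P[|{ω' | X ω' = x}]) {ω' | Y ω' = Fin.last n ∧ S ω' = Sample.o}).toReal)
    -- Δᵒ ∈ ℝ^{K−1}, with j-th entry
    -- 1{Y=y_j,S=o}/P(Y=y_j,S=o|X=x) − 1{Y=y_K,S=o}/P(Y=y_K,S=o|X=x)
    (Δo : Fin n → Ω → ℝ)
    (hΔo : ∀ (j : Fin n) (ω), Δo j ω =
      (if Y ω = j.castSucc ∧ S ω = Sample.o then (1 : ℝ) else 0) /
        ((P[|{ω' | X ω' = x}]) {ω' | Y ω' = j.castSucc ∧ S ω' = Sample.o}).toReal -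
      (if Y ω = Fin.last n ∧ S ω = Sample.o then (1 : ℝ) else 0) /
        ((P[|{ω' | X ω' = x}]) {ω' | Y ω' = Fin.last n ∧ S ω' = Sample.o}).toReal) :
    ∀ (J : ℕ), n ≤ J → ∀ H : 𝓧 × 𝓡 → Fin J → ℝ,
      (∀ i : Fin J, Measurable fun p => H p i) →
      (∃ C : ℝ, ∀ p i, |H p i| ≤ C) →
      ∀ M : Matrix (Fin J) (Fin n) ℝ,
        (M = Matrix.of fun i j => ∫ ω, H (x, R ω) i * Δo j ω ∂(P[|{ω | X ω = x}])) →
        (fun i : Fin J => ∫ ω, H (x, R ω) i * Δe ω ∂(P[|{ω | X ω = x}])) =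
            M.mulVec μ ∧
          (M.rank = n → ∀ m : Fin n → ℝ,
            (fun i : Fin J => ∫ ω, H (x, R ω) i * Δe ω ∂(P[|{ω | X ω = x}])) =
              M.mulVec m → m = μ) := by
  intro J _ H hHm hHb M hM
  obtain ⟨C, hC⟩ := hHb
  have hYm : Measurable Y := by
    rw [funext hYdef]
    exact Measurable.ite (hD (measurableSet_singleton true)) hY1 hY0
  have hSs : ∀ s, MeasurableSet {ω | S ω = s} := fun s => hS (t := {s}) trivial
  have hDs : ∀ b, MeasurableSet {ω | D ω = b} := fun b => hD (measurableSet_singleton b)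
  have hYs : ∀ j, MeasurableSet {ω | Y ω = j} := fun j => hYm (measurableSet_singleton j)
  have hXs : MeasurableSet {ω | X ω = x} := hX (measurableSet_singleton x)
  have hfm : ∀ i, Measurable fun r => H (x, r) i :=
    fun i => (hHm i).comp measurable_prodMk_left
  have hint : ∀ i, Integrable (fun ω => H (x, R ω) i) P := fun i =>
    Integrable.of_bound ((hfm i).comp hR).aestronglyMeasurable C
      (Filter.Eventually.of_forall fun ω => hC _ i)
  set a : Fin J → Fin (n + 1) → ℝ := fun i j =>
    ∫ ω, H (x, R ω) i ∂(P[|{ω | (X ω, Y ω) = (x, j)}])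
  have hcell : ∀ i j b s,
      ∫ ω in {ω | (X ω, D ω, Y ω) = (x, b, j) ∧ S ω = s}, H (x, R ω) i ∂P =
        P.real {ω | (X ω, D ω, Y ω) = (x, b, j) ∧ S ω = s} * a i j := by
    intro i j b s
    refine setIntegral_eq_of_cond_map_eq hR (hfm i) fun hpos => ?_
    rw [stability _ _ hpos]
    have hset : {ω | (X ω, D ω, Y ω) = (x, b, j)} = {ω | (X ω, Y ω) = (x, j) ∧ D ω = b} := by
      ext ω; simp only [Set.mem_ofPred_eq, Prod.mk.injEq]; tauto
    rw [hset]
    refine noDirectEffect (x, j) b (hpos.trans_le (measure_mono ?_))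
    rintro ω ⟨h, -⟩
    rw [← hset]; exact h
  have hobs : ∀ i j,
      ∫ ω in {ω | X ω = x} ∩ {ω | Y ω = j ∧ S ω = Sample.o}, H (x, R ω) i ∂P =
        P.real ({ω | X ω = x} ∩ {ω | Y ω = j ∧ S ω = Sample.o}) * a i j := by
    intro i j
    have hB : MeasurableSet ({ω | X ω = x} ∩ {ω | Y ω = j ∧ S ω = Sample.o}) :=
      hXs.inter ((hYs j).inter (hSs _))
    have hset : ∀ b, ({ω | X ω = x} ∩ {ω | Y ω = j ∧ S ω = Sample.o}) ∩ {ω | D ω = b} =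
        {ω | (X ω, D ω, Y ω) = (x, b, j) ∧ S ω = Sample.o} := by
      intro b; ext ω; simp only [Set.mem_inter_iff, Set.mem_ofPred_eq, Prod.mk.injEq]; tauto
    have hmass := setIntegral_eq_sum_fiber (P := P) hD hB (integrable_const (1 : ℝ))
    simp only [integral_const, smul_eq_mul, mul_one, measureReal_restrict_apply_univ] at hmass
    rw [setIntegral_eq_sum_fiber hD hB (hint i), hmass, Finset.sum_mul]
    exact Finset.sum_congr rfl fun b _ => by rw [hset, hcell]
  have hobs_pos : ∀ j, P.real ({ω | X ω = x} ∩ {ω | Y ω = j ∧ S ω = Sample.o}) ≠ 0 := by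
    intro j
    refine (ENNReal.toReal_pos ?_ (measure_ne_top _ _)).ne'
    refine ((positivity_o j).trans_le (measure_mono ?_)).ne'
    rintro ω ⟨h1, h2, h3⟩
    exact ⟨h2, h3, h1⟩
  set N : Set Ω := {ω | X ω = x} ∩ {ω | D ω = d ∧ S ω = Sample.e} with hN
  have hNm : MeasurableSet N := hXs.inter ((hDs d).inter (hSs _))
  have hN0 : P.real N ≠ 0 := by
    refine (ENNReal.toReal_pos ?_ (measure_ne_top _ _)).ne'
    refine ((positivity_e d 0).trans_le (measure_mono ?_)).ne'
    rintro ω ⟨h1, h2, h3, -⟩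
    exact ⟨h2, h3, h1⟩
  set p : Fin (n + 1) → ℝ := fun j => P.real (N ∩ {ω | Y ω = j}) / P.real N with hp
  have hpsum : ∑ j, p j = 1 := by
    have hmass := setIntegral_eq_sum_fiber (P := P) hYm hNm (integrable_const (1 : ℝ))
    simp only [integral_const, smul_eq_mul, mul_one, measureReal_restrict_apply_univ] at hmass
    rw [hp, ← Finset.sum_div, ← hmass, div_self hN0]
  have hexp : ∀ i, (∫ ω in N, H (x, R ω) i ∂P) / P.real N = ∑ j, p j * a i j := by
    intro i
    rw [setIntegral_eq_sum_fiber hYm hNm (hint i), Finset.sum_div]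
    refine Finset.sum_congr rfl fun j _ => ?_
    have hset : N ∩ {ω | Y ω = j} =
        {ω | (X ω, D ω, Y ω) = (x, d, j) ∧ S ω = Sample.e} := by
      ext ω
      simp only [hN, Set.mem_inter_iff, Set.mem_ofPred_eq, Prod.mk.injEq]; tauto
    simp only [hp]
    rw [hset, hcell]
    ring
  have hμp : ∀ j : Fin n, μ j = p j.castSucc := by
    intro j
    set E : Set Ω := {ω | S ω = Sample.e ∧ X ω = x} with hE
    have hEm : MeasurableSet E := (hSs _).inter hXs
    have hE0 : P.real E ≠ 0 := by
      refine (ENNReal.toReal_pos ?_ (measure_ne_top _ _)).ne'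
      refine ((positivity_e d 0).trans_le (measure_mono ?_)).ne'
      rintro ω ⟨h1, h2, -⟩
      exact ⟨h1, h2⟩
    have hind := randomization.measure_inter_preimage_eq_mul {d}
      {q : Fin (n + 1) × Fin (n + 1) | (if d then q.2 else q.1) = j.castSucc}
      (measurableSet_singleton d) (Set.toFinite _).measurableSet
    have h1 : E ∩ (D ⁻¹' {d} ∩ (fun ω => (Y0 ω, Y1 ω)) ⁻¹'
        {q : Fin (n + 1) × Fin (n + 1) | (if d then q.2 else q.1) = j.castSucc}) =
        N ∩ {ω | Y ω = j.castSucc} := by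
      ext ω
      simp only [hE, hN, Set.mem_inter_iff, Set.mem_ofPred_eq, Set.mem_preimage,
        Set.mem_singleton_iff, hYdef ω]
      constructor
      · rintro ⟨⟨h1, h2⟩, h3, h4⟩
        exact ⟨⟨h2, h3, h1⟩, by rw [h3]; exact h4⟩
      · rintro ⟨⟨h2, h3, h1⟩, h4⟩
        rw [h3] at h4
        exact ⟨⟨h1, h2⟩, h3, h4⟩
    have h2 : E ∩ D ⁻¹' {d} = N := by
      ext ω
      simp only [hE, hN, Set.mem_inter_iff, Set.mem_ofPred_eq, Set.mem_preimage,
        Set.mem_singleton_iff]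
      tauto
    have hind' := congrArg ENNReal.toReal hind
    rw [ENNReal.toReal_mul, cond_apply hEm, cond_apply hEm P (D ⁻¹' {d}), h1, h2,
      ENNReal.toReal_mul, ENNReal.toReal_mul, ENNReal.toReal_inv] at hind'
    simp only [← measureReal_def P] at hind'
    rw [hμ j]
    simp only [hp]
    rw [eq_div_iff hN0]
    have hpre : (fun ω => (Y0 ω, Y1 ω)) ⁻¹'
        {q : Fin (n + 1) × Fin (n + 1) | (if d then q.2 else q.1) = j.castSucc} =
        {ω | (if d then Y1 ω else Y0 ω) = j.castSucc} := rfl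
    rw [hpre, mul_assoc] at hind'
    have := mul_left_cancel₀ (inv_ne_zero hE0) hind'
    rw [this, mul_comm]
  have hb : ∀ (q : Ω → Prop) [DecidablePred q], MeasurableSet {ω | q ω} → ∀ i (c : ℝ),
      Integrable (fun ω => H (x, R ω) i * ((if q ω then (1 : ℝ) else 0) / c))
        (P[|{ω | X ω = x}]) := by
    intro q _ hq i c
    have hQ : Integrable (fun ω => H (x, R ω) i) (P[|{ω | X ω = x}]) :=
      Integrable.of_bound ((hfm i).comp hR).aestronglyMeasurable C
        (Filter.Eventually.of_forall fun ω => hC _ i)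
    refine ((hQ.indicator hq).div_const c).congr (Filter.Eventually.of_forall fun ω => ?_)
    by_cases h : q ω <;> simp [h, div_eq_mul_inv]
  have hYo : ∀ j, MeasurableSet {ω | Y ω = j ∧ S ω = Sample.o} :=
    fun j => (hYs j).inter (hSs _)
  have hDe : MeasurableSet {ω | D ω = d ∧ S ω = Sample.e} := (hDs d).inter (hSs _)
  have hMij : ∀ i j, M i j = a i j.castSucc - a i (Fin.last n) := by
    intro i j
    rw [hM, Matrix.of_apply]
    simp_rw [hΔo, mul_sub]
    rw [integral_sub (hb _ (hYo _) i _) (hb _ (hYo _) i _),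
      integral_mul_indicator_div_cond hXs hx.ne' _ (hYo _),
      integral_mul_indicator_div_cond hXs hx.ne' _ (hYo _), hobs, hobs,
      mul_div_cancel_left₀ _ (hobs_pos _), mul_div_cancel_left₀ _ (hobs_pos _)]
  have hmain : (fun i : Fin J => ∫ ω, H (x, R ω) i * Δe ω ∂(P[|{ω | X ω = x}])) =
      M.mulVec μ := by
    funext i
    simp_rw [hΔe, mul_sub]
    rw [integral_sub (hb _ hDe i _) (hb _ (hYo _) i _),
      integral_mul_indicator_div_cond hXs hx.ne' _ hDe,
      integral_mul_indicator_div_cond hXs hx.ne' _ (hYo _), hobs,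
      mul_div_cancel_left₀ _ (hobs_pos _), ← hN, hexp]
    simp only [Matrix.mulVec, dotProduct, hMij, hμp]
    rw [Fin.sum_univ_castSucc] at hpsum ⊢
    simp only [sub_mul, Finset.sum_sub_distrib, ← Finset.mul_sum]
    rw [eq_sub_of_add_eq hpsum]
    simp only [mul_comm (a i _)]
    ring
  refine ⟨hmain, fun hrank m hm => ?_⟩
  have hli : LinearIndependent ℝ M.col := by
    rw [linearIndependent_iff_card_eq_finrank_span, Fintype.card_fin, Set.finrank,
      ← Matrix.rank_eq_finrank_span_cols, hrank]
  exact (Matrix.mulVec_injective_iff.2 hli) (hm.symm.trans hmain)
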